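/- arXiv:2106.01034 — 2 statements merged into one kernel-verified Lean document; each statement's English description precedes it below -/
import Mathlib

section
/- (Theorem 4, lower bounds by enlarging the interference functions.) For each j ≠ i, let φ'_{i,j} : ℝ≥0 → ℝ≥0 be nondecreasing with φ'_{i,j}(x) ≥ φ_{i,j}(x) for all x ≥ 0, and let ψ'_i(x) = x + Σ_{j≠i} φ'_{i,j}(x). Then the lower pseudo-inverses satisfy (ψ'_i)↓(y) ≤ (ψ_i)↓(y) for all y ≥ 0; in particular, for every nondecreasing β : ℝ≥0 → ℝ≥0, (ψ'_i)↓ ∘ β ≤ γ_i ∘ β pointwise. -/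
open Finset Set

/-- Positive part `[x]^+ = max(x,0)`. -/
noncomputable def pospart (x : ℝ) : ℝ := max x 0

/-- Stair function `ν_{a,b}(t) = a⌈t/b⌉`. -/
noncomputable def stair (a b t : ℝ) : ℝ := a * (Int.ceil (t / b) : ℝ)

/-- Min-plus convolution on `[0,t]`. -/
noncomputable def mpConv (f g : ℝ → ℝ) (t : ℝ) : ℝ :=
  sInf ((fun s => f (t - s) + g s) '' Set.Icc 0 t)

/-- Min-plus deconvolution `(f ⊘ g)(t) = sup_{s ≥ 0} (f(t+s) − g(s))`. -/
noncomputable def mpDeconv (f g : ℝ → ℝ) (t : ℝ) : ℝ :=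
  sSup ((fun s => f (t + s) - g s) '' Set.Ici 0)

/-- Lower pseudo-inverse `f↓(y) = inf {x ≥ 0 | f(x) ≥ y}`. -/
noncomputable def lpi (f : ℝ → ℝ) (y : ℝ) : ℝ :=
  sInf {x : ℝ | 0 ≤ x ∧ y ≤ f x}

/-- Real remainder of `x` modulo `Q`, lying in `[0,Q)`. -/
noncomputable def rmod (x Q : ℝ) : ℝ := x - Q * (Int.floor (x / Q) : ℝ)

/-- Horizontal deviation `h(α,β) = sup_{t ≥ 0} inf {e ≥ 0 | α(t) ≤ β(t+e)}`. -/
noncomputable def hDev (f g : ℝ → ℝ) : ℝ :=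
  sSup {z : ℝ | ∃ t : ℝ, 0 ≤ t ∧ z = sInf {e : ℝ | 0 ≤ e ∧ f t ≤ g (t + e)}}

/-- Non-decreasing closure `g↑(t) = sup_{0 ≤ s ≤ t} g(s)`. -/
noncomputable def ndClosure (g : ℝ → ℝ) (t : ℝ) : ℝ :=
  sSup (g '' Set.Icc 0 t)

/-- Non-decreasing and non-negative closure `[g]^+↑(t) = sup_{0 ≤ s ≤ t} max(g(s),0)`. -/
noncomputable def posNdClosure (g : ℝ → ℝ) (t : ℝ) : ℝ :=
  sSup ((fun s => max (g s) 0) '' Set.Icc 0 t)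

/-- Interference function `φ_{i,j}(x) = ⌊(x+d_i)/Q_i⌋·Q_j + Q_j + d_j`. -/
noncomputable def phi {n : ℕ} (Q d : Fin n → ℝ) (i j : Fin n) (x : ℝ) : ℝ :=
  (Int.floor ((x + d i) / Q i) : ℝ) * Q j + Q j + d j

/-- `ψ_i(x) = x + Σ_{j ≠ i} φ_{i,j}(x)`. -/
noncomputable def psi {n : ℕ} (Q d : Fin n → ℝ) (i : Fin n) (x : ℝ) : ℝ :=
  x + ∑ j ∈ Finset.univ.erase i, phi Q d i j x

/-- `ψ_i^J(x) = x + Σ_{j ∈ J} φ_{i,j}(x)`. -/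
noncomputable def psiJ {n : ℕ} (Q d : Fin n → ℝ) (i : Fin n) (J : Finset (Fin n)) (x : ℝ) : ℝ :=
  x + ∑ j ∈ J, phi Q d i j x

/-- The non-convex DRR curve
`γ_i(x) = (λ_1 ⊗ ν_{Q_i,Q_tot})([x − ψ_i(Q_i−d_i)]^+) + min([x − Σ_{j≠i}(Q_j+d_j)]^+, Q_i−d_i)`. -/
noncomputable def gam {n : ℕ} (Q d : Fin n → ℝ) (i : Fin n) (x : ℝ) : ℝ :=
  mpConv (fun t => t) (stair (Q i) (∑ j, Q j)) (pospart (x - psi Q d i (Q i - d i)))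
  + min (pospart (x - ∑ j ∈ Finset.univ.erase i, (Q j + d j))) (Q i - d i)

theorem psi_eq_aux {n : ℕ} (Q d : Fin n → ℝ) (i : Fin n) (x : ℝ) :
    psi Q d i x = x + ((Int.floor ((x + d i) / Q i) : ℝ) * (∑ j ∈ Finset.univ.erase i, Q j)
      + ∑ j ∈ Finset.univ.erase i, (Q j + d j)) := by
  unfold psi phi
  rw [Finset.mul_sum, ← Finset.sum_add_distrib]
  congr 1
  exact Finset.sum_congr rfl (fun j _ => by ring)

theorem psi_ge_aux {n : ℕ} (Q d : Fin n → ℝ) (hQ : ∀ j, 0 < Q j) (i : Fin n) (x : ℝ) (k : ℤ)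
    (hk : (k : ℝ) * Q i ≤ x + d i) :
    x + ((k : ℝ) * (∑ j ∈ Finset.univ.erase i, Q j)
      + ∑ j ∈ Finset.univ.erase i, (Q j + d j)) ≤ psi Q d i x := by
  rw [psi_eq_aux]
  have hR : 0 ≤ ∑ j ∈ Finset.univ.erase i, Q j := Finset.sum_nonneg (fun j _ => (hQ j).le)
  have h1 : k ≤ Int.floor ((x + d i) / Q i) := Int.le_floor.2 ((le_div_iff₀ (hQ i)).2 hk)
  have h2 : (k : ℝ) ≤ (Int.floor ((x + d i) / Q i) : ℝ) := by exact_mod_cast h1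
  have := mul_le_mul_of_nonneg_right h2 hR
  linarith

theorem lpi_le_aux (f : ℝ → ℝ) (x y : ℝ) (hx : 0 ≤ x) (h : y ≤ f x) : lpi f y ≤ x :=
  csInf_le ⟨0, fun _ hz => hz.1⟩ ⟨hx, h⟩

theorem lpi_psi_le_gam_aux {n : ℕ} (Q d : Fin n → ℝ)
    (hQ : ∀ j, 0 < Q j) (hd : ∀ j, 0 ≤ d j ∧ d j < Q j) (i : Fin n) (y : ℝ) :
    lpi (psi Q d i) y ≤ gam Q d i y := by
  have hpa : psi Q d i (Q i - d i) = (Q i - d i) + (∑ j ∈ Finset.univ.erase i, Q j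
      + ∑ j ∈ Finset.univ.erase i, (Q j + d j)) := by
    rw [psi_eq_aux]
    have : (Q i - d i + d i) / Q i = 1 := by
      rw [sub_add_cancel, div_self (hQ i).ne']
    rw [this]; simp
  have hT : ∑ j, Q j = Q i + ∑ j ∈ Finset.univ.erase i, Q j :=
    (Finset.add_sum_erase _ _ (Finset.mem_univ i)).symm
  have hge := psi_ge_aux Q d hQ i
  have hR : 0 ≤ ∑ j ∈ Finset.univ.erase i, Q j := Finset.sum_nonneg (fun j _ => (hQ j).le)
  have hq := hQ i
  have hdi := hd i
  unfold gam
  rw [hpa, hT]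
  generalize (∑ j ∈ Finset.univ.erase i, Q j) = R at *
  have hS : 0 ≤ ∑ j ∈ Finset.univ.erase i, (Q j + d j) :=
    Finset.sum_nonneg (fun j _ => add_nonneg (hQ j).le (hd j).1)
  generalize (∑ j ∈ Finset.univ.erase i, (Q j + d j)) = S at *
  rcases le_or_gt y (Q i - d i + (R + S)) with hy | hy
  · have h0 : pospart (y - (Q i - d i + (R + S))) = 0 := max_eq_right (by linarith)
    have h1 : mpConv (fun t => t) (stair (Q i) (Q i + R)) 0 = 0 := by
      simp [mpConv, stair]
    rw [h0, h1, zero_add]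
    rcases le_total (pospart (y - S)) (Q i - d i) with h | h
    · rw [min_eq_left h]
      have p0 : 0 ≤ pospart (y - S) := le_max_right _ _
      have p1 : y - S ≤ pospart (y - S) := le_max_left _ _
      apply lpi_le_aux _ _ _ p0
      have := hge (pospart (y - S)) 0 (by push_cast; linarith)
      push_cast at this
      linarith
    · rw [min_eq_right h]
      exact lpi_le_aux _ _ _ (by linarith) (by rw [hpa]; exact hy)
  · have h0 : pospart (y - (Q i - d i + (R + S))) = y - (Q i - d i + (R + S)) :=
      max_eq_left (by linarith)
    have h1 : min (pospart (y - S)) (Q i - d i) = Q i - d i :=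
      min_eq_right (le_trans (by linarith) (le_max_left _ _))
    rw [h0, h1, ← sub_le_iff_le_add]
    apply le_csInf
    · exact Set.Nonempty.image _ ⟨0, le_refl _, by linarith⟩
    · rintro _ ⟨s, ⟨hs0, hs1⟩, rfl⟩
      have hTp : 0 < Q i + R := by linarith
      have hc : s ≤ (Int.ceil (s / (Q i + R)) : ℝ) * (Q i + R) :=
        (div_le_iff₀ hTp).1 (Int.le_ceil _)
      have hc0 : (0 : ℝ) ≤ (Int.ceil (s / (Q i + R)) : ℝ) := by
        exact_mod_cast Int.ceil_nonneg (div_nonneg hs0 hTp.le)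
      simp only [stair]
      generalize Int.ceil (s / (Q i + R)) = k at *
      rw [sub_le_iff_le_add]
      have hk := mul_nonneg hq.le hc0
      apply lpi_le_aux _ _ _ (by linarith)
      refine le_trans ?_ (hge _ (k + 1) (by push_cast; linarith))
      push_cast
      linarith

theorem lower_bound_by_enlarging_interference {n : ℕ} (hn : 2 ≤ n) (Q d : Fin n → ℝ)
    (hQ : ∀ j, 0 < Q j) (hd : ∀ j, 0 ≤ d j ∧ d j < Q j) (i : Fin n)
    (phi' : Fin n → ℝ → ℝ)
    (hmono : ∀ j ∈ Finset.univ.erase i, MonotoneOn (phi' j) (Set.Ici 0))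
    (hnn : ∀ j ∈ Finset.univ.erase i, ∀ x : ℝ, 0 ≤ x → 0 ≤ phi' j x)
    (hge : ∀ j ∈ Finset.univ.erase i, ∀ x : ℝ, 0 ≤ x → phi Q d i j x ≤ phi' j x) :
    (∀ y : ℝ, 0 ≤ y →
      lpi (fun x => x + ∑ j ∈ Finset.univ.erase i, phi' j x) y ≤ lpi (psi Q d i) y) ∧
    (∀ β : ℝ → ℝ, MonotoneOn β (Set.Ici 0) → (∀ t : ℝ, 0 ≤ t → 0 ≤ β t) →
      ∀ t : ℝ, 0 ≤ t →
        lpi (fun x => x + ∑ j ∈ Finset.univ.erase i, phi' j x) (β t) ≤ gam Q d i (β t)) := by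
  have key : ∀ y : ℝ,
      lpi (fun x => x + ∑ j ∈ Finset.univ.erase i, phi' j x) y ≤ lpi (psi Q d i) y := by
    intro y
    apply le_csInf
    · refine ⟨max y 0, le_max_right _ _, ?_⟩
      have h := psi_ge_aux Q d hQ i (max y 0) 0
        (by simpa using add_nonneg (le_max_right y 0) (hd i).1)
      have hS : 0 ≤ ∑ j ∈ Finset.univ.erase i, (Q j + d j) :=
        Finset.sum_nonneg (fun j _ => add_nonneg (hQ j).le (hd j).1)
      have := le_max_left y 0
      push_cast at h
      linarith
    · rintro x ⟨hx, hxy⟩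
      apply lpi_le_aux _ _ _ hx
      refine hxy.trans ?_
      have := Finset.sum_le_sum (fun j hj => hge j hj x hx)
      simp only [psi]
      linarith
  exact ⟨fun y _ => key y,
    fun β _ _ t _ => (key _).trans (lpi_psi_le_gam_aux Q d hQ hd i _)⟩
end

section
/- (Corollary 1, min-latency rate-latency lower bound.) Let R_min = (Q_i − d_i)/(Q_tot − d_i) and T_min = Σ_{j≠i}( Q_j + d_j ). Then for all x ≥ 0, R_min·[x − T_min]^+ ≤ γ_i(x). -/
open Finset Set

theorem conv_lower (a b r u : ℝ) (hb : 0 < b) (hr1 : r ≤ 1) (hrab : r * b ≤ a)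
    (ha : 0 < a) (hu : 0 ≤ u) :
    r * u ≤ mpConv (fun t => t) (stair a b) u := by
  unfold mpConv
  apply le_csInf
  · exact ⟨_, Set.mem_image_of_mem _ (Set.left_mem_Icc.mpr hu)⟩
  · rintro _ ⟨s, ⟨hs0, hsu⟩, rfl⟩
    simp only [stair]
    have h1 : s / b ≤ (Int.ceil (s / b) : ℝ) := Int.le_ceil _
    have h2 : a * (s / b) ≤ a * (Int.ceil (s / b) : ℝ) := mul_le_mul_of_nonneg_left h1 ha.le
    have h3 : r * s ≤ a * (s / b) := by
      rw [← mul_div_assoc, le_div_iff₀ hb]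
      nlinarith [mul_le_mul_of_nonneg_right hrab hs0]
    nlinarith [mul_le_mul_of_nonneg_right hr1 (sub_nonneg.mpr hsu)]

theorem min_latency_rate_latency_lower_bound {n : ℕ} (hn : 2 ≤ n) (Q d : Fin n → ℝ)
    (hQ : ∀ j, 0 < Q j) (hd : ∀ j, 0 ≤ d j ∧ d j < Q j) (i : Fin n) :
    ∀ x : ℝ, 0 ≤ x →
      (Q i - d i) / ((∑ j, Q j) - d i) *
          pospart (x - ∑ j ∈ Finset.univ.erase i, (Q j + d j))
        ≤ gam Q d i x := by
  intro x hx
  have hqi := hQ i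
  obtain ⟨hd0, hdi⟩ := hd i
  have hsum : Q i + ∑ j ∈ Finset.univ.erase i, Q j = ∑ j, Q j :=
    Finset.add_sum_erase _ _ (Finset.mem_univ i)
  have hpsi : psi Q d i (Q i - d i)
      = (∑ j ∈ Finset.univ.erase i, (Q j + d j)) + ((∑ j, Q j) - d i) := by
    have hf : (Q i - d i + d i) / Q i = 1 := by
      rw [sub_add_cancel, div_self hqi.ne']
    simp only [psi, phi, hf, Int.floor_one, Int.cast_one, one_mul, Finset.sum_add_distrib]
    linarith
  have hrest : 0 ≤ ∑ j ∈ Finset.univ.erase i, Q j :=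
    Finset.sum_nonneg fun j _ => (hQ j).le
  unfold gam
  rw [hpsi, ← sub_sub]
  generalize x - ∑ j ∈ Finset.univ.erase i, (Q j + d j) = y
  generalize (∑ j, Q j) = S at *
  have hP : 0 < S - d i := by linarith
  have hS : 0 < S := by linarith
  set r := (Q i - d i) / (S - d i) with hr
  have hrP : r * (S - d i) = Q i - d i := div_mul_cancel₀ _ hP.ne'
  have hr0 : 0 ≤ r := div_nonneg (by linarith) hP.le
  have hr1 : r ≤ 1 := (div_le_one hP).mpr (by linarith)
  have hrS : r * S ≤ Q i := by nlinarith
  have hc := conv_lower (Q i) S r (pospart (y - (S - d i))) hS hr1 hrS hqi (le_max_right _ _)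
  refine le_trans ?_ (add_le_add_left hc _)
  unfold pospart
  rcases le_total y 0 with h | h
  · rw [max_eq_right h, max_eq_right (by linarith), min_eq_left (by linarith)]
    simp
  · rw [max_eq_left h]
    rcases le_total y (S - d i) with h2 | h2
    · rw [max_eq_right (by linarith), mul_zero, zero_add]
      exact le_min (by nlinarith) (by nlinarith)
    · rw [max_eq_left (by linarith), min_eq_right (by linarith)]
      linarith
end
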